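/- arXiv:1111.3277 — 2 statements merged into one kernel-verified Lean document; each statement's English description precedes it below -/
import Mathlib

section
/- Let q be a prime of the form q = 6n + 5 with n ≥ 3. Then for every natural number u with 0 ≤ u ≤ q − 1 there exists a finite simple graph which is (q + 3 − u)-regular, has girth exactly 5, and has exactly 2(q(q − u) − 1) vertices. -/
open SimpleGraph

/-- The edges `i < j` of a graph on `{0, …, q - 1}` in which adjacent vertices differ by `1`, `4` or
`5` modulo `q`. Every nonzero vertex has degree `3`; the vertex `0` is isolated if `b = true` and has
degree `4` if `b = false`. -/
def UpEdge (q : ℕ) (b : Bool) (i j : ℕ) : Prop :=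
  (j = i + 1 ∧ 1 ≤ i) ∨ (j = i + 5 ∧ i % 2 = 0 ∧ 2 ≤ i) ∨ (i = 1 ∧ j + 3 = q) ∨
    (i = 3 ∧ j + 1 = q) ∨
    (b = true ∧ ((i = 1 ∧ j = 5) ∨ (i + 5 = q ∧ j + 1 = q))) ∨
    (b = false ∧ i = 0 ∧ (j = 1 ∨ j = 5 ∨ j + 5 = q ∨ j + 1 = q))

theorem UpEdge.lt {q : ℕ} (hq : 23 ≤ q) {b : Bool} {i j : ℕ} (h : UpEdge q b i j) : i < j := by
  unfold UpEdge at h; omega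

theorem UpEdge.weight {q : ℕ} {b : Bool} {i j : ℕ} (h : UpEdge q b i j) :
    ∃ w ∈ ({1, 4, 5} : Finset ℕ), j = i + w ∨ j + w = i + q := by
  unfold UpEdge at h
  rcases h with h | h | h | h | h | h
  · exact ⟨1, by simp, by omega⟩
  · exact ⟨5, by simp, by omega⟩
  · exact ⟨4, by simp, by omega⟩
  · exact ⟨4, by simp, by omega⟩
  · exact ⟨4, by simp, by omega⟩
  · by_cases h1 : j = 1 ∨ j + 1 = q
    · exact ⟨1, by simp, by omega⟩
    · exact ⟨5, by simp, by omega⟩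

theorem UpEdge.no_triangle {q : ℕ} (hq : 23 ≤ q) (ho : q % 2 = 1) {b : Bool} {i j k : ℕ}
    (hk : k < q)
    (h1 : UpEdge q b i j) (h2 : UpEdge q b j k) (h3 : UpEdge q b i k) : False := by
  unfold UpEdge at *
  cases b <;> simp only [reduceCtorEq, false_and, true_and, or_false, false_or] at h1 h2 h3 <;>
  rcases h1 with h1 | h1 | h1 | h1 | h1 <;> rcases h2 with h2 | h2 | h2 | h2 | h2 <;> omega

theorem UpEdge.no_square_of_min {q : ℕ} (hq : 23 ≤ q) (ho : q % 2 = 1) {b : Bool} {i j k l : ℕ}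
    (hk : k < q) (hj : j < q) (hl : l < q) (hik : i < k) (hjl : j < l)
    (h1 : UpEdge q b i j) (h2 : UpEdge q b i l)
    (h3 : UpEdge q b j k ∨ UpEdge q b k j) (h4 : UpEdge q b l k ∨ UpEdge q b k l) : False := by
  unfold UpEdge at *
  cases b <;> simp only [reduceCtorEq, false_and, true_and, or_false, false_or] at h1 h2 h3 h4 <;>
  rcases h1 with h1 | h1 | h1 | h1 | h1 <;> rcases h2 with h2 | h2 | h2 | h2 | h2 <;> omega

set_option maxHeartbeats 1600000 in
theorem UpEdge.neighbors {q : ℕ} (hq : 23 ≤ q) (ho : q % 2 = 1) (b : Bool) {i : ℕ} (hi : i < q)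
    (h0 : i ≠ 0) : ∃ x y z, x < y ∧ y < z ∧ z < q ∧
      ∀ j < q, (UpEdge q b i j ∨ UpEdge q b j i) ↔ (j = x ∨ j = y ∨ j = z) := by
  by_cases hs : i = 1 ∨ i = 3 ∨ i = 5 ∨ i + 1 = q ∨ i + 3 = q ∨ i + 5 = q
  swap
  · by_cases h9 : i % 2 = 0
    · refine ⟨i - 1, i + 1, i + 5, by omega, by omega, by omega, fun j _ => ⟨?_, ?_⟩⟩
      · unfold UpEdge
        rintro (h | h) <;> omega
      · rintro (rfl | rfl | rfl)
        · exact Or.inr (Or.inl ⟨by omega, by omega⟩)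
        · exact Or.inl (Or.inl ⟨rfl, by omega⟩)
        · exact Or.inl (Or.inr (Or.inl ⟨rfl, by omega, by omega⟩))
    · refine ⟨i - 5, i - 1, i + 1, by omega, by omega, by omega, fun j _ => ⟨?_, ?_⟩⟩
      · unfold UpEdge
        rintro (h | h) <;> omega
      · rintro (rfl | rfl | rfl)
        · exact Or.inr (Or.inr (Or.inl ⟨by omega, by omega, by omega⟩))
        · exact Or.inr (Or.inl ⟨by omega, by omega⟩)
        · exact Or.inl (Or.inl ⟨rfl, by omega⟩)
  unfold UpEdge
  cases b <;> simp only [reduceCtorEq, false_and, true_and, or_false, false_or]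
  · by_cases h1 : i = 1
    · exact ⟨0, 2, q - 3, by omega, by omega, by omega, by omega⟩
    by_cases h3 : i = 3
    · exact ⟨2, 4, q - 1, by omega, by omega, by omega, by omega⟩
    by_cases h5 : i = 5
    · exact ⟨0, 4, 6, by omega, by omega, by omega, by omega⟩
    by_cases h6 : i + 1 = q
    · exact ⟨0, 3, q - 2, by omega, by omega, by omega, by omega⟩
    by_cases h7 : i + 3 = q
    · exact ⟨1, q - 4, q - 2, by omega, by omega, by omega, by omega⟩
    by_cases h8 : i + 5 = q
    · exact ⟨0, q - 6, q - 4, by omega, by omega, by omega, by omega⟩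
    omega
  · by_cases h1 : i = 1
    · exact ⟨2, 5, q - 3, by omega, by omega, by omega, by omega⟩
    by_cases h3 : i = 3
    · exact ⟨2, 4, q - 1, by omega, by omega, by omega, by omega⟩
    by_cases h5 : i = 5
    · exact ⟨1, 4, 6, by omega, by omega, by omega, by omega⟩
    by_cases h6 : i + 1 = q
    · exact ⟨3, q - 5, q - 2, by omega, by omega, by omega, by omega⟩
    by_cases h7 : i + 3 = q
    · exact ⟨1, q - 4, q - 2, by omega, by omega, by omega, by omega⟩
    by_cases h8 : i + 5 = q
    · exact ⟨q - 6, q - 4, q - 1, by omega, by omega, by omega, by omega⟩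
    omega

/-- The graph on `ZMod q` whose edges are given by `UpEdge q b` on representatives. -/
def blockGraph (q : ℕ) (b : Bool) : SimpleGraph (ZMod q) :=
  SimpleGraph.fromRel fun y z => UpEdge q b y.val z.val

theorem blockGraph_adj {q : ℕ} (hq : 23 ≤ q) {b : Bool} {y z : ZMod q} :
    (blockGraph q b).Adj y z ↔ UpEdge q b y.val z.val ∨ UpEdge q b z.val y.val := by
  rw [blockGraph, SimpleGraph.fromRel_adj, and_iff_right_iff_imp]
  rintro (h | h) rfl <;> exact (h.lt hq).ne rfl

theorem blockGraph_weight {q : ℕ} (hq : 23 ≤ q) {b : Bool} {y z : ZMod q}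
    (h : (blockGraph q b).Adj y z) :
    ∃ w ∈ ({1, 4, 5} : Finset ℕ), z = y + w ∨ y = z + w := by
  have : NeZero q := ⟨by omega⟩
  have key : ∀ y z : ZMod q, UpEdge q b y.val z.val →
      ∃ w ∈ ({1, 4, 5} : Finset ℕ), z = y + w ∨ y = z + w := by
    intro y z h
    obtain ⟨w, hw, h | h⟩ := h.weight
    · refine ⟨w, hw, Or.inl ?_⟩
      simpa using congrArg (Nat.cast : ℕ → ZMod q) h
    · refine ⟨w, hw, Or.inr ?_⟩
      simpa using (congrArg (Nat.cast : ℕ → ZMod q) h).symm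
  rcases (blockGraph_adj hq).1 h with h | h
  · exact key y z h
  · obtain ⟨w, hw, h⟩ := key z y h
    exact ⟨w, hw, h.symm⟩

/-- The graph `G` has no cycles of length `3` or `4`. -/
def NoShortCycles {V : Type*} (G : SimpleGraph V) : Prop :=
  (∀ a b c, G.Adj a b → G.Adj b c → ¬ G.Adj c a) ∧
    ∀ a b c d, G.Adj a b → G.Adj b c → G.Adj c d → G.Adj d a → a = c ∨ b = d

theorem NoShortCycles.comap {V W : Type*} {G : SimpleGraph W} (h : NoShortCycles G) {f : V → W}
    (hf : Function.Injective f) : NoShortCycles (G.comap f) :=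
  ⟨fun _ _ _ h1 h2 h3 => h.1 _ _ _ h1 h2 h3,
    fun _ _ _ _ h1 h2 h3 h4 => (h.2 _ _ _ _ h1 h2 h3 h4).imp (@hf _ _) (@hf _ _)⟩

theorem NoShortCycles.five_le_egirth {V : Type*} {G : SimpleGraph V} (h : NoShortCycles G) :
    5 ≤ G.egirth := by
  rw [SimpleGraph.le_egirth]
  intro a w hw
  have h3 := hw.three_le_length
  by_contra! hlt
  have hlt' : w.length < 5 := by exact_mod_cast hlt
  match w, hw with
  | .cons h1 (.cons h2 (.cons h3 .nil)), _ => exact h.1 _ _ _ h1 h2 h3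
  | .cons (v := b) h1 (.cons (v := c) h2 (.cons (v := d) h3 (.cons h4 .nil))), hw =>
    have hn := hw.support_nodup
    rcases h.2 _ _ _ _ h1 h2 h3 h4 with rfl | rfl <;> simp at hn
  | .nil, _ | .cons _ .nil, _ | .cons _ (.cons _ .nil), _ => simp at h3
  | .cons _ (.cons _ (.cons _ (.cons _ (.cons _ _)))), _ => simp at hlt'; omega

theorem blockGraph_noShortCycles {q : ℕ} (hq : 23 ≤ q) (ho : q % 2 = 1) (b : Bool) :
    NoShortCycles (blockGraph q b) := by
  have : NeZero q := ⟨by omega⟩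
  have adj := @blockGraph_adj q hq b
  refine ⟨fun x y z h1 h2 h3 => ?_, ?_⟩
  · have t := @UpEdge.no_triangle q hq ho b
    rw [adj] at h1 h2 h3
    have lt := @UpEdge.lt q hq b
    have hx := x.val_lt
    have hy := y.val_lt
    have hz := z.val_lt
    rcases h1 with h1 | h1 <;> rcases h2 with h2 | h2 <;> rcases h3 with h3 | h3
    · have := lt h1; have := lt h2; have := lt h3; omega
    · exact t hz h1 h2 h3
    · exact t hy h3 h1 h2
    · exact t hy h3 h2 h1
    · exact t hx h2 h3 h1
    · exact t hz h1 h3 h2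
    · exact t hx h2 h1 h3
    · have := lt h1; have := lt h2; have := lt h3; omega
  · have key : ∀ x y z w, (blockGraph q b).Adj x y → (blockGraph q b).Adj y z →
        (blockGraph q b).Adj z w → (blockGraph q b).Adj w x →
        ¬ (x.val < z.val ∧ y.val < w.val ∧ x.val < y.val) := by
      intro x y z w h1 h2 h3 h4 ⟨hxz, hyw, hxy⟩
      rw [adj] at h1 h2 h3 h4
      have lt := @UpEdge.lt q hq b
      refine UpEdge.no_square_of_min hq ho z.val_lt y.val_lt w.val_lt hxz hyw
        (h1.resolve_right fun h => ?_) (h4.symm.resolve_right fun h => ?_) h2 h3.symm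
      · exact absurd (lt h) (by omega)
      · exact absurd (lt h) (by omega)
    intro x y z w h1 h2 h3 h4
    by_contra! hne
    have hxz : x.val ≠ z.val := fun h => hne.1 (ZMod.val_injective q h)
    have hyw : y.val ≠ w.val := fun h => hne.2 (ZMod.val_injective q h)
    have hxy : x.val ≠ y.val := fun h => h1.ne (ZMod.val_injective q h)
    have hyz : y.val ≠ z.val := fun h => h2.ne (ZMod.val_injective q h)
    have hzw : z.val ≠ w.val := fun h => h3.ne (ZMod.val_injective q h)
    have hwx : w.val ≠ x.val := fun h => h4.ne (ZMod.val_injective q h)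
    rcases hxz.lt_or_gt with hxz | hzx <;> rcases hyw.lt_or_gt with hyw | hwy
    · rcases hxy.lt_or_gt with h | h
      · exact key x y z w h1 h2 h3 h4 ⟨hxz, hyw, h⟩
      · exact key y x w z h1.symm h4.symm h3.symm h2.symm ⟨hyw, hxz, h⟩
    · rcases hwx.lt_or_gt with h | h
      · exact key w x y z h4 h1 h2 h3 ⟨hwy, hxz, h⟩
      · exact key x w z y h4.symm h3.symm h2.symm h1.symm ⟨hxz, hwy, h⟩
    · rcases hyz.lt_or_gt with h | h
      · exact key y z w x h2 h3 h4 h1 ⟨hyw, hzx, h⟩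
      · exact key z y x w h2.symm h1.symm h4.symm h3.symm ⟨hzx, hyw, h⟩
    · rcases hzw.lt_or_gt with h | h
      · exact key z w x y h3 h4 h1 h2 ⟨hzx, hwy, h⟩
      · exact key w z y x h3.symm h2.symm h1.symm h4.symm ⟨hwy, hzx, h⟩

theorem ncard_neighborSet_blockGraph {q : ℕ} (hq : 23 ≤ q) (ho : q % 2 = 1) {b : Bool}
    {y : ZMod q} (hy : y ≠ 0) : ((blockGraph q b).neighborSet y).ncard = 3 := by
  have : NeZero q := ⟨by omega⟩
  obtain ⟨i, j, k, hij, hjk, hk, h⟩ := UpEdge.neighbors hq ho b y.val_lt ((ZMod.val_ne_zero y).2 hy)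
  have hi' : (i : ZMod q).val = i := ZMod.val_cast_of_lt (by omega)
  have hj' : (j : ZMod q).val = j := ZMod.val_cast_of_lt (by omega)
  have hk' : (k : ZMod q).val = k := ZMod.val_cast_of_lt (by omega)
  rw [Set.ncard_eq_three]
  refine ⟨i, j, k, ?_, ?_, ?_, ?_⟩
  · intro e; rw [e] at hi'; omega
  · intro e; rw [e] at hi'; omega
  · intro e; rw [e] at hj'; omega
  · ext z
    have inj : ∀ {t : ℕ}, (t : ZMod q).val = t → (z.val = t ↔ z = t) := fun ht =>
      ⟨fun e => by rw [← e, ZMod.natCast_zmod_val], fun e => by rw [e, ht]⟩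
    simp [blockGraph_adj hq, h z.val z.val_lt, inj hi', inj hj', inj hk']

theorem ncard_neighborSet_blockGraph_zero {q : ℕ} (hq : 23 ≤ q) :
    ((blockGraph q false).neighborSet 0).ncard = 4 := by
  have : NeZero q := ⟨by omega⟩
  have : (blockGraph q false).neighborSet 0 =
      (({1, 5, q - 5, q - 1} : Finset ℕ).image (Nat.cast : ℕ → ZMod q) : Finset (ZMod q)) := by
    ext z
    have hz := z.val_lt
    simp only [mem_neighborSet, blockGraph_adj hq, ZMod.val_zero, Finset.coe_image, Set.mem_image,
      Finset.mem_coe, Finset.mem_insert, Finset.mem_singleton]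
    constructor
    · intro h
      refine ⟨z.val, ?_, ZMod.natCast_zmod_val z⟩
      simp only [UpEdge, reduceCtorEq, false_and, true_and, false_or] at h
      omega
    · rintro ⟨t, ht, rfl⟩
      rw [ZMod.val_cast_of_lt (by omega)]
      simp only [UpEdge, reduceCtorEq, false_and, true_and, false_or]
      omega
  rw [this, Set.ncard_coe_finset, Finset.card_image_of_injOn]
  · rw [Finset.card_insert_of_notMem, Finset.card_insert_of_notMem, Finset.card_pair] <;>
      simp <;> omega
  · intro s hs t ht e
    simp only [Finset.coe_insert, Finset.coe_singleton, Set.mem_insert_iff,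
      Set.mem_singleton_iff] at hs ht
    have := congrArg ZMod.val e
    rwa [ZMod.val_cast_of_lt (by omega), ZMod.val_cast_of_lt (by omega)] at this

theorem not_blockGraph_true_adj_zero {q : ℕ} (hq : 23 ≤ q) (y : ZMod q) :
    ¬ (blockGraph q true).Adj y 0 := by
  have : NeZero q := ⟨by omega⟩
  have := y.val_lt
  rw [blockGraph_adj hq, ZMod.val_zero]
  unfold UpEdge
  rintro (h | h) <;> simp at h <;> omega

section Semiplane

variable {F : Type*} [Field F]

/-- The graph on the points `(true, x, y)` and the lines `(false, m, b)` of the affine plane without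
its vertical direction, in which a point is adjacent to a line when `y + b = x * m`, and the points
(lines) with a common first coordinate `x` span a copy of `Γ true x` (`Γ false x`). -/
def semiplaneGraph (Γ : Bool → F → SimpleGraph F) : SimpleGraph (Bool × F × F) where
  Adj p r := (p.1 = r.1 ∧ p.2.1 = r.2.1 ∧ (Γ p.1 p.2.1).Adj p.2.2 r.2.2) ∨
    (p.1 ≠ r.1 ∧ p.2.2 + r.2.2 = p.2.1 * r.2.1)
  symm.symm := by
    rintro ⟨s, x, y⟩ ⟨t, m, b⟩ (⟨h1, h2, h3⟩ | ⟨h1, h2⟩)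
    · dsimp only at h1 h2 h3
      subst h1 h2
      exact Or.inl ⟨rfl, rfl, h3.symm⟩
    · exact Or.inr ⟨h1.symm, by linear_combination h2⟩
  loopless.irrefl := by
    rintro ⟨s, x, y⟩ (⟨_, _, h3⟩ | ⟨h1, _⟩)
    · exact h3.ne rfl
    · exact h1 rfl

theorem semiplaneGraph_adj_same {Γ : Bool → F → SimpleGraph F} {s : Bool} {x y z w : F} :
    (semiplaneGraph Γ).Adj (s, x, y) (s, z, w) ↔ x = z ∧ (Γ s x).Adj y w := by
  simp [semiplaneGraph]

theorem semiplaneGraph_adj_not {Γ : Bool → F → SimpleGraph F} {s : Bool} {x y z w : F} :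
    (semiplaneGraph Γ).Adj (s, x, y) (!s, z, w) ↔ y + w = x * z := by
  simp [semiplaneGraph]

theorem semiplaneGraph_adj_not' {Γ : Bool → F → SimpleGraph F} {s : Bool} {x y z w : F} :
    (semiplaneGraph Γ).Adj (!s, x, y) (s, z, w) ↔ y + w = x * z := by
  simp [semiplaneGraph]

theorem semiplaneGraph_noShortCycles {Γ : Bool → F → SimpleGraph F}
    (hΓ : ∀ s x, NoShortCycles (Γ s x))
    (hw : ∀ s x m y z b c, (Γ s x).Adj y z → (Γ (!s) m).Adj b c → y + b ≠ z + c) :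
    NoShortCycles (semiplaneGraph Γ) := by
  have sides : ∀ s t : Bool, s = t ∨ (!s) = t := by decide
  constructor
  · rintro ⟨s, x₁, y₁⟩ ⟨t, x₂, y₂⟩ ⟨r, x₃, y₃⟩ h1 h2 h3
    rcases sides s t with rfl | rfl <;> rcases sides s r with rfl | rfl <;>
      simp only [semiplaneGraph_adj_same, semiplaneGraph_adj_not, semiplaneGraph_adj_not']
        at h1 h2 h3
    · obtain ⟨rfl, h1⟩ := h1
      obtain ⟨rfl, h2⟩ := h2
      exact (hΓ _ _).1 _ _ _ h1 h2 h3.2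
    · obtain ⟨rfl, h1⟩ := h1
      exact h1.ne (by linear_combination h3 - h2)
    · obtain ⟨rfl, h3⟩ := h3
      exact h3.ne (by linear_combination h2 - h1)
    · obtain ⟨rfl, h2⟩ := h2
      exact h2.ne (by linear_combination h1 - h3)
  · rintro ⟨s, x₁, y₁⟩ ⟨t, x₂, y₂⟩ ⟨r, x₃, y₃⟩ ⟨v, x₄, y₄⟩ h1 h2 h3 h4
    rcases sides s t with rfl | rfl <;> rcases sides s r with rfl | rfl <;>
      rcases sides s v with rfl | rfl <;>
      simp only [semiplaneGraph_adj_same, semiplaneGraph_adj_not, semiplaneGraph_adj_not',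
        Prod.mk.injEq, true_and] at h1 h2 h3 h4 ⊢
    · obtain ⟨rfl, h1⟩ := h1
      obtain ⟨rfl, h2⟩ := h2
      obtain ⟨rfl, h3⟩ := h3
      simpa using (hΓ _ _).2 _ _ _ _ h1 h2 h3 h4.2
    · obtain ⟨rfl, h1⟩ := h1
      obtain ⟨rfl, h2⟩ := h2
      exact Or.inl ⟨rfl, by linear_combination h4 - h3⟩
    · obtain ⟨rfl, h1⟩ := h1
      obtain ⟨rfl, h4⟩ := h4
      exact Or.inr ⟨rfl, by linear_combination h2 - h3⟩
    · obtain ⟨rfl, h1⟩ := h1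
      obtain ⟨rfl, h3⟩ := h3
      exact (hw _ _ _ _ _ _ _ h1 h3.symm (by linear_combination h4 - h2)).elim
    · obtain ⟨rfl, h3⟩ := h3
      obtain ⟨rfl, h4⟩ := h4
      exact Or.inl ⟨rfl, by linear_combination h1 - h2⟩
    · have h : (x₁ - x₃) * (x₂ - x₄) = 0 := by linear_combination h2 + h4 - h1 - h3
      rcases mul_eq_zero.1 h with h | h
      · obtain rfl := sub_eq_zero.1 h
        exact Or.inl ⟨rfl, by linear_combination h1 - h2⟩
      · obtain rfl := sub_eq_zero.1 h
        exact Or.inr ⟨rfl, by linear_combination h1 - h4⟩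
    · obtain ⟨rfl, h2⟩ := h2
      obtain ⟨rfl, h4⟩ := h4
      exact (hw _ _ _ _ _ _ _ h4.symm h2 (by linear_combination h1 - h3)).elim
    · obtain ⟨rfl, h2⟩ := h2
      obtain ⟨rfl, h3⟩ := h3
      exact Or.inr ⟨rfl, by linear_combination h1 - h4⟩

end Semiplane

theorem ncard_setOf_val_lt {q : ℕ} [NeZero q] {k : ℕ} (hk : k ≤ q) :
    {x : ZMod q | x.val < k}.ncard = k := by
  have h : {x : ZMod q | x.val < k} = (Nat.cast : ℕ → ZMod q) '' (Finset.range k : Set ℕ) := by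
    ext x
    simp only [Set.mem_ofPred_eq, Set.mem_image, Finset.coe_range, Set.mem_Iio]
    constructor
    · exact fun hx => ⟨x.val, hx, ZMod.natCast_zmod_val x⟩
    · rintro ⟨t, ht, rfl⟩
      rwa [ZMod.val_cast_of_lt (by omega)]
  have inj : Set.InjOn (Nat.cast : ℕ → ZMod q) (Finset.range k : Set ℕ) := by
    intro s hs t ht e
    simp only [Finset.coe_range, Set.mem_Iio] at hs ht
    have := congrArg ZMod.val e
    rwa [ZMod.val_cast_of_lt (by omega), ZMod.val_cast_of_lt (by omega)] at this
  rw [h, inj.ncard_image, Set.ncard_coe_finset, Finset.card_range]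

theorem egirth_le_five {V : Type*} {G : SimpleGraph V} {a b c d e : V} (hab : G.Adj a b)
    (hbc : G.Adj b c) (hcd : G.Adj c d) (hde : G.Adj d e) (hea : G.Adj e a)
    (hn : [a, b, c, d, e].Nodup) : G.egirth ≤ 5 := by
  have hw : (Walk.cons hab (.cons hbc (.cons hcd (.cons hde (.cons hea .nil))))).IsCycle := by
    rw [Walk.cons_isCycle_iff]
    simp only [List.nodup_cons, List.mem_cons, List.not_mem_nil, or_false, not_or] at hn
    obtain ⟨⟨h1, h2, h3, h4⟩, ⟨h5, h6, h7⟩, ⟨h8, h9⟩, h10, -⟩ := hn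
    constructor
    · simp [Walk.isPath_def]
      grind
    · simp
      grind
  exact_mod_cast egirth_le_length hw

/-- The graph `blockGraph` attached to a point (`s = true`) or line (`s = false`) block with label
`x`. Line blocks are rescaled by `2`, which makes their edge differences differ from those of the
point blocks. -/
def scaledBlockGraph (q : ℕ) (s : Bool) (x : ZMod q) : SimpleGraph (ZMod q) :=
  (blockGraph q (decide (x = 0))).comap fun y => (if s then 1 else 2) * y

section Prime

variable {q : ℕ} [hp : Fact q.Prime]

theorem scale_ne_zero (hq : 23 ≤ q) (s : Bool) : (if s then 1 else 2 : ZMod q) ≠ 0 := by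
  cases s
  · have : ((2 : ℕ) : ZMod q) ≠ 0 := by
      rw [Ne, ZMod.natCast_eq_zero_iff]
      exact fun h => absurd (Nat.le_of_dvd (by norm_num) h) (by omega)
    simpa using this
  · simp

theorem scaledBlockGraph_noShortCycles (hq : 23 ≤ q) (ho : q % 2 = 1) (s : Bool) (x : ZMod q) :
    NoShortCycles (scaledBlockGraph q s x) :=
  (blockGraph_noShortCycles hq ho _).comap (mul_right_injective₀ (scale_ne_zero hq s))

theorem blockGraph_weights_separated (hq : 23 ≤ q) {b b' : Bool} {x y z w : ZMod q}
    (h : (blockGraph q b).Adj x y) (h' : (blockGraph q b').Adj (2 * z) (2 * w)) :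
    x + z ≠ y + w := by
  obtain ⟨v, hv, h⟩ := blockGraph_weight hq h
  obtain ⟨v', hv', h'⟩ := blockGraph_weight hq h'
  have bound : ∀ v ∈ ({1, 4, 5} : Finset ℕ), ∀ v' ∈ ({1, 4, 5} : Finset ℕ),
      (2 * v : ℤ) - v' ≠ 0 ∧ |(2 * v : ℤ) - v'| < 23 ∧ (2 * v : ℤ) + v' ≠ 0 ∧
        |(2 * v : ℤ) + v'| < 23 := by decide
  obtain ⟨hs, hs', ha, ha'⟩ := bound v hv v' hv'
  have sub_ne : (2 * v : ZMod q) - v' ≠ 0 := fun e => hs <| Int.eq_zero_of_abs_lt_dvd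
    ((ZMod.intCast_zmod_eq_zero_iff_dvd _ q).1 (by push_cast; exact e)) (by omega)
  have add_ne : (2 * v : ZMod q) + v' ≠ 0 := fun e => ha <| Int.eq_zero_of_abs_lt_dvd
    ((ZMod.intCast_zmod_eq_zero_iff_dvd _ q).1 (by push_cast; exact e)) (by omega)
  intro e
  rcases h with h | h <;> rcases h' with h' | h'
  · exact add_ne (by linear_combination -2 * e - 2 * h - h')
  · exact sub_ne (by linear_combination -2 * e - 2 * h + h')
  · exact sub_ne (by linear_combination 2 * e - 2 * h + h')
  · exact add_ne (by linear_combination 2 * e - 2 * h - h')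

theorem scaledBlockGraph_separated (hq : 23 ≤ q) (s : Bool) (x m y z b c : ZMod q)
    (h : (scaledBlockGraph q s x).Adj y z) (h' : (scaledBlockGraph q (!s) m).Adj b c) :
    y + b ≠ z + c := by
  cases s
  · simp only [scaledBlockGraph, comap_adj, Bool.not_false, if_true, one_mul, Bool.false_eq_true,
      if_false] at h h'
    rw [add_comm y, add_comm z]
    exact blockGraph_weights_separated hq h' h
  · simp only [scaledBlockGraph, comap_adj, Bool.not_true, if_true, one_mul, Bool.false_eq_true,
      if_false] at h h'
    exact blockGraph_weights_separated hq h h'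

theorem ncard_neighborSet_scaledBlockGraph (hq : 23 ≤ q) (ho : q % 2 = 1) (s : Bool)
    {x y : ZMod q} (hxy : (x, y) ≠ 0) :
    ((scaledBlockGraph q s x).neighborSet y).ncard = if y = 0 then 4 else 3 := by
  have hs := scale_ne_zero hq s
  have h : (scaledBlockGraph q s x).neighborSet y = (fun z => (if s then 1 else 2) * z) ⁻¹'
      (blockGraph q (decide (x = 0))).neighborSet ((if s then 1 else 2) * y) := rfl
  rw [h, Set.ncard_preimage_of_injective_subset_range (mul_right_injective₀ hs)
    (by rw [(mul_left_surjective₀ hs).range_eq]; exact Set.subset_univ _)]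
  by_cases hy : y = 0
  · rw [if_pos hy]
    subst hy
    have hx : x ≠ 0 := fun e => hxy (Prod.mk_eq_zero.2 ⟨e, rfl⟩)
    rw [mul_zero, decide_eq_false hx, ncard_neighborSet_blockGraph_zero hq]
  · rw [if_neg hy]
    exact ncard_neighborSet_blockGraph hq ho (mul_ne_zero hs hy)

/-- The points and lines whose block label is less than `k`, without the two origins. -/
def keptVertices (q k : ℕ) : Set (Bool × ZMod q × ZMod q) :=
  {p | p.2.1.val < k ∧ p.2 ≠ 0}

theorem ncard_keptVertices {k : ℕ} (h0 : 0 < k) (hk : k ≤ q) :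
    (keptVertices q k).ncard = 2 * (q * k - 1) := by
  have h : keptVertices q k =
      (Set.univ : Set Bool) ×ˢ (({x : ZMod q | x.val < k} ×ˢ Set.univ) \ {0}) := by
    ext p
    simp [keptVertices]
  rw [h, Set.ncard_prod, Set.ncard_sdiff_singleton_of_mem (by simpa using h0), Set.ncard_prod,
    ncard_setOf_val_lt hk, Set.ncard_univ, Set.ncard_univ, Nat.card_zmod, mul_comm k]
  simp

theorem ncard_neighborSet_semiplane (hq : 23 ≤ q) (ho : q % 2 = 1) {k : ℕ} (h0 : 0 < k)
    (hk : k ≤ q) (p : keptVertices q k) :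
    (((semiplaneGraph (scaledBlockGraph q)).induce (keptVertices q k)).neighborSet p).ncard =
      k + 3 := by
  obtain ⟨⟨s, x, y⟩, hx, hxy⟩ := p
  dsimp only at hx hxy
  set A : Set (ZMod q) := {m | m.val < k} \ (if y = 0 then {0} else ∅) with hA
  have h : (Subtype.val : keptVertices q k → _) ''
      ((semiplaneGraph (scaledBlockGraph q)).induce (keptVertices q k)).neighborSet
        ⟨(s, x, y), hx, hxy⟩ =
      (fun z => (s, x, z)) '' (scaledBlockGraph q s x).neighborSet y ∪
        (fun m => (!s, m, x * m - y)) '' A := by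
    ext ⟨t, m, b⟩
    have sides : ∀ s t : Bool, s = t ∨ (!s) = t := by decide
    rcases sides s t with rfl | rfl
    · simp only [Set.mem_image, mem_neighborSet, comap_adj, Function.Embedding.subtype_apply,
        Subtype.exists, exists_and_right, exists_eq_right, semiplaneGraph_adj_same, Set.mem_union,
        Prod.mk.injEq, Bool.not_eq_eq_eq_not, true_and, keptVertices, Set.mem_ofPred_eq]
      constructor
      · rintro ⟨⟨-, rfl⟩, h⟩
        exact Or.inl ⟨b, h, rfl, rfl⟩
      · rintro (⟨z, h, rfl, rfl⟩ | ⟨m, -, h, -⟩)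
        · refine ⟨⟨⟨hx, fun e => ?_⟩, rfl⟩, h⟩
          obtain ⟨rfl, rfl⟩ := Prod.mk_eq_zero.1 e
          rw [scaledBlockGraph, comap_adj, mul_zero, decide_eq_true rfl] at h
          exact not_blockGraph_true_adj_zero hq _ h
        · simp at h
    · simp only [Set.mem_image, mem_neighborSet, comap_adj, Function.Embedding.subtype_apply,
        Subtype.exists, exists_and_right, exists_eq_right, semiplaneGraph_adj_not, Set.mem_union,
        Prod.mk.injEq, true_and, keptVertices, Set.mem_ofPred_eq]
      have hmem : m ∈ A ↔ m.val < k ∧ ¬ (y = 0 ∧ m = 0) := by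
        by_cases hy : y = 0 <;> simp [hA, hy]
      constructor
      · rintro ⟨⟨hm, hmb⟩, h⟩
        refine Or.inr ⟨m, hmem.2 ⟨hm, ?_⟩, rfl, by linear_combination -h⟩
        rintro ⟨rfl, rfl⟩
        exact hmb (Prod.mk_eq_zero.2 ⟨rfl, by linear_combination h⟩)
      · rintro (⟨z, -, h, -⟩ | ⟨m, hm, rfl, rfl⟩)
        · simp at h
        · obtain ⟨hm, hne⟩ := hmem.1 hm
          refine ⟨⟨hm, fun e => hne ?_⟩, by ring⟩
          obtain ⟨rfl, e⟩ := Prod.mk_eq_zero.1 e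
          exact ⟨by linear_combination -e, rfl⟩
  have cardA : A.ncard + (if y = 0 then 4 else 3) = k + 3 := by
    rw [hA]
    split_ifs with hy
    · rw [Set.ncard_sdiff_singleton_of_mem (by simpa using h0), ncard_setOf_val_lt hk]
      omega
    · rw [Set.sdiff_empty, ncard_setOf_val_lt hk]
  rw [← Set.ncard_image_of_injective _ Subtype.val_injective, h, Set.ncard_union_eq,
    Set.ncard_image_of_injective, Set.ncard_image_of_injective,
    ncard_neighborSet_scaledBlockGraph hq ho s hxy, ← cardA, add_comm]
  · exact fun m m' e => (Prod.mk.inj (Prod.mk.inj e).2).1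
  · exact fun m m' e => (Prod.mk.inj (Prod.mk.inj e).2).2
  · rw [Set.disjoint_left]
    rintro _ ⟨z, -, rfl⟩ ⟨m, -, e⟩
    simp at e

theorem egirth_semiplane (hq : 23 ≤ q) (ho : q % 2 = 1) {k : ℕ} (h0 : 0 < k) :
    ((semiplaneGraph (scaledBlockGraph q)).induce (keptVertices q k)).egirth = 5 := by
  refine le_antisymm ?_ ((semiplaneGraph_noShortCycles (scaledBlockGraph_noShortCycles hq ho)
    (scaledBlockGraph_separated hq)).comap Subtype.val_injective).five_le_egirth
  have cast_ne : ∀ {n : ℕ}, 0 < n → n < q → (n : ZMod q) ≠ 0 := fun h h' e =>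
    absurd (Nat.le_of_dvd h ((ZMod.natCast_eq_zero_iff _ q).1 e)) (by omega)
  have adj : ∀ n : ℕ, 0 < n → n + 1 < q →
      (blockGraph q true).Adj (n : ZMod q) ((n + 1 : ℕ) : ZMod q) := fun n h h' => by
    rw [blockGraph_adj hq, ZMod.val_cast_of_lt (by omega), ZMod.val_cast_of_lt h']
    exact Or.inl (Or.inl ⟨rfl, h⟩)
  have mem : ∀ (s : Bool) {y : ZMod q}, y ≠ 0 → (s, (0, y)) ∈ keptVertices q k := fun s y hy =>
    ⟨by simpa using h0, fun e => hy (Prod.mk_eq_zero.1 e).2⟩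
  obtain ⟨h, hh⟩ : ∃ h : ZMod q, 2 * h = ((11 : ℕ) : ZMod q) := by
    refine ⟨(((q + 11) / 2 : ℕ) : ZMod q), ?_⟩
    have : 2 * ((q + 11) / 2) = q + 11 := by omega
    simpa using congrArg (Nat.cast : ℕ → ZMod q) this
  have n5 := @cast_ne 5 (by norm_num) (by omega)
  have n6 := @cast_ne 6 (by norm_num) (by omega)
  have m5 := @cast_ne (q - 5) (by omega) (by omega)
  have m6 := @cast_ne (q - 6) (by omega) (by omega)
  have nh : h ≠ 0 := fun e => @cast_ne 11 (by norm_num) (by omega) (by rw [← hh, e, mul_zero])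
  have e5 : ((q - 5 : ℕ) : ZMod q) = -5 := by rw [Nat.cast_sub (by omega)]; simp
  have e6 : ((q - 6 : ℕ) : ZMod q) = -6 := by rw [Nat.cast_sub (by omega)]; simp
  have a1 := adj 10 (by norm_num) (by omega)
  have a2 := adj 11 (by norm_num) (by omega)
  have a3 := adj (q - 6) (by omega) (by omega)
  rw [show q - 6 + 1 = q - 5 by omega] at a3
  have ne56 : (5 : ZMod q) ≠ 6 := fun e => one_ne_zero (α := ZMod q) (by linear_combination -e)
  have f1 : (scaledBlockGraph q false 0).Adj ((5 : ℕ) : ZMod q) h := by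
    simp only [scaledBlockGraph, comap_adj, decide_true, Bool.false_eq_true, if_false, hh]
    convert a1 using 1
    norm_num
  have f2 : (scaledBlockGraph q false 0).Adj h ((6 : ℕ) : ZMod q) := by
    simp only [scaledBlockGraph, comap_adj, decide_true, Bool.false_eq_true, if_false, hh]
    convert a2 using 1
    norm_num
  have f3 : (scaledBlockGraph q true 0).Adj ((q - 6 : ℕ) : ZMod q) ((q - 5 : ℕ) : ZMod q) := by
    simpa only [scaledBlockGraph, comap_adj, decide_true, if_true, one_mul] using a3
  refine egirth_le_five (a := ⟨_, mem true m5⟩) (b := ⟨_, mem false n5⟩) (c := ⟨_, mem false nh⟩)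
    (d := ⟨_, mem false n6⟩) (e := ⟨_, mem true m6⟩) ?_ ?_ ?_ ?_ ?_ ?_
  · exact Or.inr ⟨by simp, by simp [e5]⟩
  · exact Or.inl ⟨rfl, rfl, f1⟩
  · exact Or.inl ⟨rfl, rfl, f2⟩
  · exact Or.inr ⟨by simp, by simp [e6]⟩
  · exact Or.inl ⟨rfl, rfl, f3⟩
  · have := f1.ne
    have := f2.ne
    have := f3.ne'
    simp_all

end Prime

/-- For every prime `q = 6n + 5` with `n ≥ 3` and every `0 ≤ u ≤ q - 1`, there is a
`(q + 3 - u)`-regular graph of girth exactly `5` with `2 * (q * (q - u) - 1)` vertices. -/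
theorem exists_regular_girth_five_6n5 (q n : ℕ) (hq : Nat.Prime q)
    (hqn : q = 6 * n + 5) (hn : 3 ≤ n) (u : ℕ) (hu : u ≤ q - 1) :
    ∃ (V : Type) (G : SimpleGraph V), Finite V ∧
      (∀ v, (G.neighborSet v).ncard = q + 3 - u) ∧
      G.egirth = 5 ∧
      Nat.card V = 2 * (q * (q - u) - 1) := by
  have : Fact q.Prime := ⟨hq⟩
  have hq' : 23 ≤ q := by omega
  have ho : q % 2 = 1 := by omega
  have h0 : 0 < q - u := by omega
  refine ⟨keptVertices q (q - u), (semiplaneGraph (scaledBlockGraph q)).induce _, inferInstance,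
    fun v => ?_, egirth_semiplane hq' ho h0, ?_⟩
  · rw [ncard_neighborSet_semiplane hq' ho h0 (Nat.sub_le q u)]
    omega
  · rw [Nat.card_coe_set_eq, ncard_keptVertices h0 (Nat.sub_le q u)]
end

section
/- For every natural number u with 0 ≤ u ≤ 12 there exists a finite simple graph which is (16 − u)-regular, has girth exactly 5, and has exactly 336 − 26u vertices. In particular there exists a 16-regular graph of girth 5 on 336 vertices. -/
open SimpleGraph

/-- The edges, each listed once, of the two graphs placed inside the blocks. With `true` the graph is
cubic of girth `5` on the nonzero residues; with `false` it has girth `5`, degree `4` at `0` and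
degree `3` elsewhere. All differences of adjacent residues are squares modulo `13`. -/
def blockEdges : Bool → List (ZMod 13 × ZMod 13)
  | true => [(1, 2), (1, 4), (1, 5), (2, 6), (2, 11), (3, 4), (3, 6), (3, 12), (4, 7), (5, 8),
      (5, 9), (6, 9), (7, 8), (7, 10), (8, 12), (9, 10), (10, 11), (11, 12)]
  | false => [(0, 1), (0, 3), (0, 4), (0, 12), (1, 2), (1, 10), (2, 5), (2, 11), (3, 6), (3, 7),
      (4, 5), (4, 8), (5, 6), (6, 9), (7, 8), (7, 10), (8, 11), (9, 10), (9, 12), (11, 12)]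

/-- Adjacency in the block graphs. -/
abbrev BlockAdj (e : Bool) (y z : ZMod 13) : Prop :=
  (y, z) ∈ blockEdges e ∨ (z, y) ∈ blockEdges e

/-- The dilation applied to the residues of a block of points (`false`) or lines (`true`); that of
the lines is a non-square. -/
abbrev blockScale : Bool → ZMod 13
  | false => 1
  | true => 7

lemma Bool.eq_of_ne_of_ne {i j k : Bool} (hij : i ≠ j) (hjk : j ≠ k) : i = k := by
  revert i j k
  decide

lemma BlockAdj.symm {e : Bool} {y z : ZMod 13} (h : BlockAdj e y z) : BlockAdj e z y :=
  Or.symm h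

lemma BlockAdj.sub_pow {e : Bool} {y z : ZMod 13} : BlockAdj e y z → (y - z) ^ 6 = 1 := by
  revert e y z
  decide +kernel

lemma BlockAdj.ne {e : Bool} {y z : ZMod 13} (h : BlockAdj e y z) : y ≠ z := by
  rintro rfl
  have := h.sub_pow
  rw [sub_self] at this
  exact absurd this (by decide)

lemma BlockAdj.no_triangle {e : Bool} {a b c : ZMod 13} :
    BlockAdj e a b → BlockAdj e b c → ¬ BlockAdj e c a := by
  have h : ∀ e a b, BlockAdj e a b → ∀ c, BlockAdj e b c → ¬ BlockAdj e c a := by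
    decide +kernel
  exact fun hab => h e a b hab c

lemma BlockAdj.no_square {e : Bool} {a b c d : ZMod 13} (hac : a ≠ c) (hbd : b ≠ d) :
    BlockAdj e a b → BlockAdj e b c → BlockAdj e c d → ¬ BlockAdj e d a := by
  have h : ∀ e a c, a ≠ c →
      (Finset.univ.filter fun b => BlockAdj e a b ∧ BlockAdj e b c).card ≤ 1 := by
    decide +kernel
  intro hab hbc hcd hda
  exact hbd (Finset.card_le_one.1 (h e a c hac) b (by simp only [Finset.mem_filter_univ, hab, hbc,
    and_self]) d (by simp only [Finset.mem_filter_univ, hda.symm, hcd.symm, and_self]))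

lemma blockScale_mul_injective (i : Bool) : Function.Injective (blockScale i * ·) := by
  revert i
  decide +kernel

lemma card_blockAdj_zero (i : Bool) :
    (Finset.univ.filter fun z => BlockAdj false 0 (blockScale i * z)).card = 4 := by
  revert i
  decide +kernel

lemma card_blockAdj_of_ne_zero (i e : Bool) (y : ZMod 13) (hy : y ≠ 0) :
    (Finset.univ.filter fun z => BlockAdj e (blockScale i * y) (blockScale i * z)).card = 3 := by
  revert i e y
  decide +kernel

lemma not_blockAdj_true_zero (y : ZMod 13) : ¬ BlockAdj true y 0 := by
  revert y
  decide +kernel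

/-- The incidence graph of the points `(false, x, y)` and the lines `(true, m, b)` of an elliptic
semiplane, a point being on a line when `y + b = x * m`, amalgamated with a block graph inside each
set of points with the same `x` and each set of lines with the same `m`. -/
def amalgam : SimpleGraph (Bool × ZMod 13 × ZMod 13) where
  Adj p q := (p.1 = q.1 ∧ p.2.1 = q.2.1 ∧
      BlockAdj (decide (p.2.1 = 0)) (blockScale p.1 * p.2.2) (blockScale p.1 * q.2.2)) ∨
    (p.1 ≠ q.1 ∧ p.2.2 + q.2.2 = p.2.1 * q.2.1)
  symm := by
    constructor
    rintro ⟨i, x, y⟩ ⟨j, m, b⟩ (⟨h₁, h₂, h₃⟩ | ⟨h₁, h₂⟩)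
    · dsimp only at h₁ h₂ h₃
      subst h₁ h₂
      exact Or.inl ⟨rfl, rfl, h₃.symm⟩
    · exact Or.inr ⟨h₁.symm, by rw [add_comm, mul_comm]; exact h₂⟩
  loopless := by
    constructor
    rintro ⟨i, x, y⟩ (⟨-, -, h⟩ | ⟨h, -⟩)
    · exact h.ne rfl
    · exact h rfl

lemma amalgam_adj_same {i : Bool} {x y m b : ZMod 13} :
    amalgam.Adj (i, x, y) (i, m, b) ↔
      x = m ∧ BlockAdj (decide (x = 0)) (blockScale i * y) (blockScale i * b) := by
  simp [amalgam]

lemma amalgam_adj_of_ne {i j : Bool} (hij : i ≠ j) {x y m b : ZMod 13} :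
    amalgam.Adj (i, x, y) (j, m, b) ↔ y + b = x * m := by
  simp [amalgam, hij]

/-- Two vertices of a block with a common neighbour of the other kind are equal. -/
lemma amalgam_eq_of_adj_of_adj {i j : Bool} (hij : i ≠ j) {x y z m b : ZMod 13}
    (h₁ : amalgam.Adj (i, x, y) (j, m, b)) (h₂ : amalgam.Adj (i, x, z) (j, m, b)) : y = z := by
  rw [amalgam_adj_of_ne hij] at h₁ h₂
  linear_combination h₁ - h₂

/-- Edges inside a block of points and a block of lines are never matched to each other. -/
lemma amalgam_no_parallel {i j : Bool} (hij : i ≠ j) {x y z m b c : ZMod 13}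
    (h₁ : amalgam.Adj (i, x, y) (i, x, z)) (h₂ : amalgam.Adj (i, x, z) (j, m, b))
    (h₃ : amalgam.Adj (j, m, b) (j, m, c)) (h₄ : amalgam.Adj (j, m, c) (i, x, y)) : False := by
  rw [amalgam_adj_same] at h₁ h₃
  rw [amalgam_adj_of_ne hij] at h₂
  rw [amalgam_adj_of_ne hij.symm] at h₄
  have h₅ := h₁.2.sub_pow
  have h₆ := h₃.2.sub_pow
  have h₇ : y - z = b - c := by linear_combination h₄ - h₂
  rw [← mul_sub, h₇] at h₅
  rw [← mul_sub] at h₆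
  generalize b - c = d at h₅ h₆
  clear h₁ h₂ h₃ h₄ h₇
  revert i j d
  decide +kernel

lemma amalgam_no_triangle {p q r : Bool × ZMod 13 × ZMod 13} (hpq : amalgam.Adj p q)
    (hqr : amalgam.Adj q r) (hrp : amalgam.Adj r p) : False := by
  -- a triangle has two vertices in a common block
  have key : ∀ {p q r : Bool × ZMod 13 × ZMod 13}, amalgam.Adj p q → amalgam.Adj q r →
      amalgam.Adj r p → p.1 = q.1 → p.1 ≠ r.1 → False := by
    rintro ⟨i, x, y⟩ ⟨_, x', y'⟩ ⟨j, m, b⟩ h₁ h₂ h₃ rfl hij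
    obtain ⟨rfl, -⟩ := amalgam_adj_same.1 h₁
    obtain rfl := amalgam_eq_of_adj_of_adj hij h₂ h₃.symm
    exact h₁.ne rfl
  by_cases h₁ : p.1 = q.1
  · by_cases h₂ : p.1 = r.1
    · obtain ⟨i, x, y⟩ := p
      obtain ⟨j, x', y'⟩ := q
      obtain ⟨k, x'', y''⟩ := r
      dsimp only at h₁ h₂
      subst h₁ h₂
      obtain ⟨rfl, h₃⟩ := amalgam_adj_same.1 hpq
      obtain ⟨rfl, h₄⟩ := amalgam_adj_same.1 hqr
      exact h₃.no_triangle h₄ (amalgam_adj_same.1 hrp).2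
    · exact key hpq hqr hrp h₁ h₂
  · by_cases h₂ : p.1 = r.1
    · exact key hrp hpq hqr h₂.symm fun h => h₁ (h₂.trans h)
    · have h₃ : q.1 = r.1 := Bool.eq_of_ne_of_ne (Ne.symm h₁) h₂
      exact key hqr hrp hpq h₃ fun h => h₁ h.symm

lemma amalgam_no_square {p q r s : Bool × ZMod 13 × ZMod 13} (hpr : p ≠ r) (hqs : q ≠ s)
    (hpq : amalgam.Adj p q) (hqr : amalgam.Adj q r) (hrs : amalgam.Adj r s)
    (hsp : amalgam.Adj s p) : False := by
  -- exactly three of the vertices have the same kind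
  have three : ∀ {p q r s : Bool × ZMod 13 × ZMod 13}, p ≠ r → amalgam.Adj p q →
      amalgam.Adj q r → amalgam.Adj r s → amalgam.Adj s p → p.1 = q.1 → q.1 = r.1 → p.1 ≠ s.1 →
      False := by
    rintro ⟨i, x, y⟩ ⟨_, x', y'⟩ ⟨_, x'', y''⟩ ⟨j, m, b⟩ hne h₁ h₂ h₃ h₄ rfl rfl hij
    obtain ⟨rfl, -⟩ := amalgam_adj_same.1 h₁
    obtain ⟨rfl, -⟩ := amalgam_adj_same.1 h₂
    obtain rfl := amalgam_eq_of_adj_of_adj hij h₃ h₄.symm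
    exact hne rfl
  -- two adjacent vertices are points and the other two are lines
  have two : ∀ {p q r s : Bool × ZMod 13 × ZMod 13}, amalgam.Adj p q → amalgam.Adj q r →
      amalgam.Adj r s → amalgam.Adj s p → p.1 = q.1 → r.1 = s.1 → p.1 ≠ r.1 → False := by
    rintro ⟨i, x, y⟩ ⟨_, x', y'⟩ ⟨j, m, b⟩ ⟨_, m', b'⟩ h₁ h₂ h₃ h₄ rfl rfl hij
    obtain ⟨rfl, -⟩ := amalgam_adj_same.1 h₁
    obtain ⟨rfl, -⟩ := amalgam_adj_same.1 h₃
    exact amalgam_no_parallel hij h₁ h₂ h₃ h₄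
  obtain ⟨i, x, y⟩ := p
  obtain ⟨j, m, b⟩ := q
  obtain ⟨k, x', y'⟩ := r
  obtain ⟨l, m', b'⟩ := s
  by_cases hij : i = j <;> by_cases hjk : j = k <;> by_cases hkl : k = l
  · subst hij hjk hkl
    obtain ⟨rfl, h₁⟩ := amalgam_adj_same.1 hpq
    obtain ⟨rfl, h₂⟩ := amalgam_adj_same.1 hqr
    obtain ⟨rfl, h₃⟩ := amalgam_adj_same.1 hrs
    have inj := blockScale_mul_injective i
    refine h₁.no_square (fun h => hpr ?_) (fun h => hqs ?_) h₂ h₃ (amalgam_adj_same.1 hsp).2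
    · rw [inj h]
    · rw [inj h]
  · exact three hpr hpq hqr hrs hsp hij hjk fun h => hkl (hjk.symm.trans (hij.symm.trans h))
  · exact two hpq hqr hrs hsp hij hkl fun h => hjk (hij.symm.trans h)
  · have hli : l = i := Bool.eq_of_ne_of_ne (Ne.symm hkl) fun h => hjk (hij.symm.trans h.symm)
    exact three hqs.symm hsp hpq hqr hrs hli hij fun h => hjk (hij.symm.trans (hli.symm.trans h))
  · exact three hqs hqr hrs hsp hpq hjk hkl fun h => hij h.symm
  · have hli : l = i := Bool.eq_of_ne_of_ne (Ne.symm hkl) fun h => hij (h.symm.trans hjk.symm)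
    exact two hqr hrs hsp hpq hjk hli fun h => hkl (hjk.symm.trans h)
  · have hli : l = i := Bool.eq_of_ne_of_ne (fun h => hjk (h.symm.trans hkl.symm)) (Ne.symm hij)
    exact three hpr.symm hrs hsp hpq hqr hkl hli fun h => hjk h.symm
  · have hki : k = i := Bool.eq_of_ne_of_ne (Ne.symm hjk) (Ne.symm hij)
    have hlj : l = j := Bool.eq_of_ne_of_ne (Ne.symm hkl) (Ne.symm hjk)
    subst hki hlj
    rw [amalgam_adj_of_ne hij] at hpq hrs
    rw [amalgam_adj_of_ne hjk] at hqr hsp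
    have h₀ : (x - x') * (m - m') = 0 := by linear_combination hqr + hsp - hpq - hrs
    have : Fact (Nat.Prime 13) := ⟨by norm_num⟩
    rcases mul_eq_zero.1 h₀ with h | h
    · obtain rfl := sub_eq_zero.1 h
      have : y = y' := by linear_combination hpq - hqr
      exact hpr (by rw [this])
    · obtain rfl := sub_eq_zero.1 h
      have : b = b' := by linear_combination hpq - hsp
      exact hqs (by rw [this])

/-- The vertices in the blocks indexed by `S`, without the point and the line with coordinates
`(0, 0)`. -/
def blockVertices (S : Finset (ZMod 13)) : Finset (Bool × ZMod 13 × ZMod 13) :=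
  Finset.univ ×ˢ (S ×ˢ Finset.univ).erase (0, 0)

lemma mem_blockVertices {S : Finset (ZMod 13)} {i : Bool} {x y : ZMod 13} :
    (i, x, y) ∈ blockVertices S ↔ ¬ (x = 0 ∧ y = 0) ∧ x ∈ S := by
  simp [blockVertices]

lemma card_blockVertices {S : Finset (ZMod 13)} (hS : 0 ∈ S) :
    (blockVertices S).card = 2 * (13 * S.card - 1) := by
  rw [blockVertices, Finset.card_product, Finset.card_erase_of_mem (by simp [hS]),
    Finset.card_product, Finset.card_univ, Finset.card_univ, Fintype.card_bool, ZMod.card,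
    mul_comm S.card]

lemma ncard_neighborSet_amalgam {S : Finset (ZMod 13)} (hS : 0 ∈ S) {i : Bool} {x y : ZMod 13}
    (h : (i, x, y) ∈ blockVertices S) :
    (amalgam.neighborSet (i, x, y) ∩ blockVertices S).ncard = S.card + 3 := by
  rw [mem_blockVertices] at h
  set A := (Finset.univ.filter fun z =>
    BlockAdj (decide (x = 0)) (blockScale i * y) (blockScale i * z)).image
      fun z => (i, x, z) with hA
  set B := (S.filter fun m => ¬ (m = 0 ∧ y = 0)).image fun m => (!i, m, x * m - y) with hB
  have hAB : amalgam.neighborSet (i, x, y) ∩ blockVertices S = ↑(A ∪ B) := by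
    ext ⟨j, m, b⟩
    rw [Set.mem_inter_iff, mem_neighborSet, Finset.mem_coe, Finset.mem_coe, mem_blockVertices,
      Finset.mem_union]
    by_cases hij : i = j
    · subst hij
      rw [amalgam_adj_same]
      have hnB : (i, m, b) ∉ B := by simp [hB]
      simp only [hnB, or_false, hA, Finset.mem_image, Finset.mem_filter, Finset.mem_univ,
        true_and, Prod.mk.injEq]
      constructor
      · rintro ⟨⟨rfl, h₁⟩, -⟩
        exact ⟨b, h₁, rfl, rfl⟩
      · rintro ⟨b, h₁, rfl, rfl⟩
        refine ⟨⟨rfl, h₁⟩, ?_, h.2⟩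
        rintro ⟨rfl, rfl⟩
        rw [mul_zero] at h₁
        exact not_blockAdj_true_zero _ h₁
    · rw [amalgam_adj_of_ne hij]
      have hnA : (j, m, b) ∉ A := by simp [hA, hij]
      have hj : (!i) = j := Bool.eq_of_ne_of_ne (Bool.not_ne_self i) hij
      simp only [hnA, false_or, hB, hj, Finset.mem_image, Finset.mem_filter, Prod.mk.injEq,
        true_and]
      constructor
      · rintro ⟨h₁, h₂, h₃⟩
        refine ⟨m, ⟨h₃, ?_⟩, rfl, by linear_combination -h₁⟩
        rintro ⟨rfl, rfl⟩
        exact h₂ ⟨rfl, by linear_combination h₁⟩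
      · rintro ⟨m, ⟨h₁, h₂⟩, rfl, rfl⟩
        refine ⟨by ring, ?_, h₁⟩
        rintro ⟨rfl, h₃⟩
        exact h₂ ⟨rfl, by linear_combination -h₃⟩
  have hdisj : Disjoint A B := by
    rw [Finset.disjoint_left]
    rintro ⟨j, m, b⟩ h₁ h₂
    simp only [hA, hB, Finset.mem_image, Prod.mk.injEq] at h₁ h₂
    obtain ⟨_, _, rfl, _⟩ := h₁
    obtain ⟨_, _, h₃, _⟩ := h₂
    simp at h₃
  rw [hAB, Set.ncard_coe_finset, Finset.card_union_of_disjoint hdisj, hA, hB,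
    Finset.card_image_of_injective _ fun a b hab => by simpa using hab,
    Finset.card_image_of_injective _ fun a b hab => by simp_all]
  by_cases hy : y = 0
  · subst hy
    have hx : x ≠ 0 := fun hx => h.1 ⟨hx, rfl⟩
    have hfilter : (S.filter fun m => ¬ (m = 0 ∧ (0 : ZMod 13) = 0)) = S.erase 0 := by
      ext m
      simp [and_comm]
    rw [hfilter, Finset.card_erase_of_mem hS, decide_eq_false hx, mul_zero, card_blockAdj_zero]
    have := Finset.card_pos.2 ⟨0, hS⟩
    omega
  · have hfilter : (S.filter fun m => ¬ (m = 0 ∧ y = 0)) = S := by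
      simp [hy]
    rw [hfilter, card_blockAdj_of_ne_zero i _ y hy, add_comm]

lemma SimpleGraph.five_le_egirth {V : Type*} {G : SimpleGraph V}
    (h₃ : ∀ {a b c}, G.Adj a b → G.Adj b c → G.Adj c a → False)
    (h₄ : ∀ {a b c d}, a ≠ c → b ≠ d → G.Adj a b → G.Adj b c → G.Adj c d → G.Adj d a → False) :
    5 ≤ G.egirth := by
  rw [le_egirth]
  intro a w hw
  by_contra! hlt
  have hlt : w.length < 5 := by exact_mod_cast hlt
  have hge := hw.three_le_length
  have hnd := hw.support_nodup
  match w, hlt, hge, hnd with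
  | .cons hab (.cons hbc (.cons hca .nil)), _, _, _ => exact h₃ hab hbc hca
  | .cons hab (.cons hbc (.cons hcd (.cons hda .nil))), _, _, hnd =>
    simp only [Walk.support_cons, Walk.support_nil, List.tail_cons, List.nodup_cons,
      List.mem_cons, not_or] at hnd
    exact h₄ (Ne.symm hnd.2.1.2.1) hnd.1.2.1 hab hbc hcd hda

lemma egirth_induce_amalgam {S : Finset (ZMod 13)} (hS : 0 ∈ S) :
    (amalgam.induce (blockVertices S : Set (Bool × ZMod 13 × ZMod 13))).egirth = 5 := by
  apply le_antisymm
  · have hmem : ∀ y : ZMod 13, y ≠ 0 →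
        (false, 0, y) ∈ (blockVertices S : Set (Bool × ZMod 13 × ZMod 13)) := fun y hy =>
      Finset.mem_coe.2 (mem_blockVertices.2 ⟨fun h => hy h.2, hS⟩)
    have hadj : ∀ y z : ZMod 13, BlockAdj true y z → amalgam.Adj (false, 0, y) (false, 0, z) :=
      fun y z h => amalgam_adj_same.2 ⟨rfl, by simpa using h⟩
    let v (y : ZMod 13) (hy : y ≠ 0) :
        (blockVertices S : Set (Bool × ZMod 13 × ZMod 13)) := ⟨_, hmem y hy⟩
    let G := amalgam.induce (blockVertices S : Set (Bool × ZMod 13 × ZMod 13))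
    have e₁ : G.Adj (v 1 (by decide)) (v 2 (by decide)) := hadj 1 2 (by decide)
    have e₂ : G.Adj (v 2 (by decide)) (v 6 (by decide)) := hadj 2 6 (by decide)
    have e₃ : G.Adj (v 6 (by decide)) (v 3 (by decide)) := hadj 6 3 (by decide)
    have e₄ : G.Adj (v 3 (by decide)) (v 4 (by decide)) := hadj 3 4 (by decide)
    have e₅ : G.Adj (v 4 (by decide)) (v 1 (by decide)) := hadj 4 1 (by decide)
    let w : G.Walk (v 1 (by decide)) (v 1 (by decide)) :=
      .cons e₁ (.cons e₂ (.cons e₃ (.cons e₄ (.cons e₅ .nil))))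
    have hw : w.IsCycle := by
      rw [Walk.cons_isCycle_iff]
      simp only [Walk.cons_isPath_iff, Walk.IsPath.nil, Walk.support_cons, Walk.support_nil,
        Walk.edges_cons, Walk.edges_nil, List.mem_cons, Sym2.eq_iff, v, Subtype.mk.injEq,
        Prod.mk.injEq, List.not_mem_nil, true_and, and_true, or_false]
      decide
    exact hw.egirth_le_length
  · exact five_le_egirth (fun h₁ h₂ h₃ => amalgam_no_triangle h₁ h₂ h₃)
      fun hac hbd h₁ h₂ h₃ h₄ => amalgam_no_square (Subtype.coe_injective.ne hac)
        (Subtype.coe_injective.ne hbd) h₁ h₂ h₃ h₄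

lemma ncard_neighborSet_induce {V : Type*} (G : SimpleGraph V) (s : Set V) (v : s) :
    ((G.induce s).neighborSet v).ncard = (G.neighborSet v ∩ s).ncard := by
  rw [← Set.ncard_image_of_injective _ Subtype.val_injective]
  congr 1
  ext w
  simp [and_comm]

/-- For every `0 ≤ u ≤ 12` there is a `(16 - u)`-regular graph of girth exactly `5`
on `336 - 26u` vertices; in particular there is a `16`-regular graph of girth `5`
on `336` vertices. -/
theorem exists_regular_girth_five_q13 :
    (∀ u : ℕ, u ≤ 12 →
      ∃ (V : Type) (G : SimpleGraph V), Finite V ∧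
        (∀ v, (G.neighborSet v).ncard = 16 - u) ∧
        G.egirth = 5 ∧
        Nat.card V = 336 - 26 * u) ∧
    (∃ (V : Type) (G : SimpleGraph V), Finite V ∧
      (∀ v, (G.neighborSet v).ncard = 16) ∧
      G.egirth = 5 ∧
      Nat.card V = 336) := by
  have main : ∀ u : ℕ, u ≤ 12 →
      ∃ (V : Type) (G : SimpleGraph V), Finite V ∧
        (∀ v, (G.neighborSet v).ncard = 16 - u) ∧
        G.egirth = 5 ∧
        Nat.card V = 336 - 26 * u := by
    intro u hu
    obtain ⟨S, h₀, -, hS⟩ := Finset.exists_subsuperset_card_eq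
      (Finset.subset_univ ({0} : Finset (ZMod 13))) (n := 13 - u)
      (by rw [Finset.card_singleton]; omega) (by rw [Finset.card_univ, ZMod.card]; omega)
    have h₀ : 0 ∈ S := h₀ (Finset.mem_singleton_self 0)
    refine ⟨_, amalgam.induce (blockVertices S : Set (Bool × ZMod 13 × ZMod 13)), inferInstance,
      fun v => ?_, egirth_induce_amalgam h₀, ?_⟩
    · rw [ncard_neighborSet_induce]
      refine (ncard_neighborSet_amalgam h₀ (Finset.mem_coe.1 v.2)).trans ?_
      omega
    · rw [Nat.card_coe_set_eq, Set.ncard_coe_finset, card_blockVertices h₀]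
      omega
  exact ⟨main, main 0 (Nat.zero_le _)⟩
end
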